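/- arXiv:2103.02180 — 2 statements merged into one kernel-verified Lean document; each statement's English description precedes it below -/
import Mathlib

section
/- Let X be a geometrically ruled surface over a smooth projective curve B of genus g, with invariant e > 0, section C and fibre f. Then every curve F on X satisfies l_F ≤ max{2, |2g−2−e|, l_C, l_f}. -/
/-!
Abstract model of a smooth projective surface over ℂ, recording the group of
divisors, the real Néron–Severi space with its intersection form, the canonical
divisor, the predicate of being a reduced irreducible curve, linear equivalence,
the cohomology dimensions `hⁱ(𝒪_X(D))`, the Picard number, the Kodaira dimension,
the Iitaka dimension of divisors, and the closed Mori cone `NE̅(X)`.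
-/
structure SurfaceData where
  /-- the group of divisors on the surface -/
  Div : Type
  [divAddGroup : AddCommGroup Div]
  /-- the real Néron–Severi space `N¹(X)_ℝ` -/
  N : Type
  [nAddGroup : AddCommGroup N]
  [nModule : Module ℝ N]
  /-- the numerical class of a divisor -/
  cls : Div →+ N
  /-- the intersection form on `N¹(X)_ℝ` -/
  inter : N →ₗ[ℝ] N →ₗ[ℝ] ℝ
  inter_symm : ∀ x y : N, inter x y = inter y x
  /-- intersection numbers of divisors are integers -/
  inter_int : ∀ D E : Div, ∃ n : ℤ, inter (cls D) (cls E) = (n : ℝ)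
  /-- the canonical divisor `K_X` -/
  K : Div
  /-- `IsCurve D` : `D` is a reduced, irreducible curve -/
  IsCurve : Div → Prop
  /-- linear equivalence of divisors -/
  LinEquiv : Div → Div → Prop
  /-- `h⁰(𝒪_X(D))` -/
  h0 : Div → ℕ
  /-- `h¹(𝒪_X(D))` -/
  h1 : Div → ℕ
  /-- `h²(𝒪_X(D))` -/
  h2 : Div → ℕ
  /-- the Picard number `ρ(X)` -/
  picardNumber : ℕ
  /-- the Kodaira dimension `κ(X)` (`⊥` means `−∞`) -/
  kodairaDim : WithBot ℤ
  /-- the Iitaka dimension `κ(X, D)` (`⊥` means `−∞`) -/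
  iitakaDim : Div → WithBot ℤ
  /-- the closed Mori cone `NE̅(X) ⊆ N¹(X)_ℝ` -/
  NEbar : Set N

attribute [instance] SurfaceData.divAddGroup SurfaceData.nAddGroup SurfaceData.nModule

namespace SurfaceData

variable (X : SurfaceData)

/-- the intersection number `D · E` of two divisors -/
def dot (D E : X.Div) : ℝ := X.inter (X.cls D) (X.cls E)

/-- the self-intersection number `D²` -/
def sq (D : X.Div) : ℝ := X.dot D D

/-- the irregularity `q(X) = h¹(𝒪_X)` -/
def q : ℕ := X.h1 0

/-- `χ(𝒪_X) = h⁰(𝒪_X) − h¹(𝒪_X) + h²(𝒪_X)` -/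
def chi : ℤ := (X.h0 0 : ℤ) - (X.h1 0 : ℤ) + (X.h2 0 : ℤ)

/-- numerical equivalence of divisors -/
def NumEquiv (D E : X.Div) : Prop := X.cls D = X.cls E

/-- a divisor is nef if it meets every curve non-negatively -/
def IsNef (D : X.Div) : Prop := ∀ C : X.Div, X.IsCurve C → 0 ≤ X.dot D C

/-- a divisor is big if its Iitaka dimension is `2` -/
def IsBig (D : X.Div) : Prop := X.iitakaDim D = 2

/-- ampleness, via the Nakai–Moishezon criterion on a projective surface -/
def IsAmple (D : X.Div) : Prop :=
  0 < X.sq D ∧ ∀ C : X.Div, X.IsCurve C → 0 < X.dot D C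

open Classical in
/-- the quantity `l_D`: `(K_X·D)/max{1, D²}` if `D² ≠ 0`, and
`(K_X·D)/max{1, h⁰(𝒪_X(D))}` if `D² = 0`. -/
noncomputable def l (D : X.Div) : ℝ :=
  if X.sq D = 0 then X.dot X.K D / max 1 (X.h0 D : ℝ)
  else X.dot X.K D / max 1 (X.sq D)

/-- `b(X) > 0` : the surface carries at least one negative curve -/
def bPos : Prop := ∃ C : X.Div, X.IsCurve C ∧ X.sq C < 0

/-- `X` satisfies the bounding cohomology: there is a positive constant `c_X`
with `h¹(𝒪_X(C)) ≤ c_X · h⁰(𝒪_X(C))` for every curve `C` on `X`. -/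
def BoundingCohomology : Prop :=
  ∃ cX : ℝ, 0 < cX ∧ ∀ C : X.Div, X.IsCurve C → (X.h1 C : ℝ) ≤ cX * (X.h0 C : ℝ)

/-- the closed Mori cone is `ℝ≥0[C₁] + ℝ≥0[C₂]` -/
def MoriConeGenBy (C₁ C₂ : X.Div) : Prop :=
  X.NEbar = {x : X.N | ∃ a b : ℝ, 0 ≤ a ∧ 0 ≤ b ∧ x = a • X.cls C₁ + b • X.cls C₂}

/-- the closed Mori cone is `Σᵢ ℝ≥0[Cᵢ]` -/
def MoriConeGenByFam {r : ℕ} (Cs : Fin r → X.Div) : Prop :=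
  X.NEbar = {x : X.N | ∃ c : Fin r → ℝ, (∀ i, 0 ≤ c i) ∧ x = ∑ i, c i • X.cls (Cs i)}

end SurfaceData

/-- Abstract model of a geometrically ruled surface `X = ℙ(E) → B` over a smooth
projective curve `B` of genus `g`, with invariant `e`, (unique) normalized
section `C₀` and fibre `fib`, so that `Pic X ≅ ℤC₀ ⊕ π*Pic B`, `C₀·fib = 1`,
`fib² = 0`, `C₀² = −e`, `K_X ≡ −2C₀ + (2g−2−e)fib`, and (Hartshorne V.2.20) any
irreducible curve not numerically equal to `C₀` or `fib` is numerically
`aC₀ + b·fib` with `a > 0` and `b ≥ ae`. -/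
structure RuledSurfaceData extends SurfaceData where
  /-- the genus of the base curve `B` -/
  g : ℕ
  /-- the invariant `e` of the ruled surface -/
  e : ℤ
  /-- the unique (normalized) section `C₀` -/
  C₀ : Div
  /-- a fibre of the ruling -/
  fib : Div
  curve_C₀ : IsCurve C₀
  curve_fib : IsCurve fib
  C₀_dot_fib : inter (cls C₀) (cls fib) = 1
  fib_sq : inter (cls fib) (cls fib) = 0
  C₀_sq : inter (cls C₀) (cls C₀) = -(e : ℝ)
  K_class : cls K = (-2 : ℝ) • cls C₀ + (2 * (g : ℝ) - 2 - (e : ℝ)) • cls fib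
  /-- `Pic X ≅ ℤC₀ ⊕ π*Pic B` on the level of numerical classes -/
  pic_span : ∀ D : Div, ∃ a b : ℤ, cls D = (a : ℝ) • cls C₀ + (b : ℝ) • cls fib
  /-- Hartshorne, Proposition V.2.20: numerical classes of irreducible curves -/
  curve_class : ∀ D : Div, IsCurve D →
    cls D = cls C₀ ∨ cls D = cls fib ∨
      ∃ a b : ℤ, 0 < a ∧ a * e ≤ b ∧
        cls D = (a : ℝ) • cls C₀ + (b : ℝ) • cls fib

/-- Abstract model of the blow-up `π : X → ℙ²` of the projective plane at one
point `p`, with exceptional curve `E` and `H = π*𝒪_{ℙ²}(1)`, so that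
`H² = 1`, `H·E = 0`, `E² = −1`, `K_X = π*(−3H) + E`, and any curve `C ≠ E`
has `C = π*(dH) − mE` with `0 ≤ m = mult_p(π_*C) ≤ d`. -/
structure BlowupP2Data extends SurfaceData where
  /-- the pullback `π*H` of a line `H ⊂ ℙ²` -/
  H : Div
  /-- the exceptional curve `E` -/
  E : Div
  curve_E : IsCurve E
  H_sq : inter (cls H) (cls H) = 1
  H_dot_E : inter (cls H) (cls E) = 0
  E_sq : inter (cls E) (cls E) = -1
  K_eq : K = (-3 : ℤ) • H + E
  pic_span : ∀ D : Div, ∃ a m : ℤ, D = a • H - m • E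
  /-- every curve other than `E` is `π*(dH) − mE` with `0 ≤ m ≤ d` -/
  curve_class : ∀ C : Div, IsCurve C → C ≠ E →
    ∃ d m : ℤ, 0 < d ∧ 0 ≤ m ∧ m ≤ d ∧ C = d • H - m • E

namespace SurfaceData

/-- Away from self-intersection zero, `l` depends only on the numerical class. -/
theorem l_eq_of_cls_eq (X : SurfaceData) {D E : X.Div} (h : X.cls D = X.cls E)
    (hE : X.sq E ≠ 0) : X.l D = X.l E := by
  have hsq : X.sq D = X.sq E := by simp only [sq, dot, h]
  have hK : X.dot X.K D = X.dot X.K E := by simp only [dot, h]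
  simp only [l, hsq, hK, if_neg hE]

end SurfaceData

namespace RuledSurfaceData

variable (X : RuledSurfaceData)

theorem sq_of_cls_eq {D : X.Div} {a b : ℝ} (h : X.cls D = a • X.cls X.C₀ + b • X.cls X.fib) :
    X.sq D = a * (2 * b - a * X.e) := by
  simp only [SurfaceData.sq, SurfaceData.dot, h, map_add, map_smul, LinearMap.add_apply,
    LinearMap.smul_apply, smul_eq_mul, X.inter_symm (X.cls X.fib) (X.cls X.C₀), X.C₀_dot_fib,
    X.fib_sq, X.C₀_sq]
  ring

theorem dot_K_of_cls_eq {D : X.Div} {a b : ℝ}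
    (h : X.cls D = a • X.cls X.C₀ + b • X.cls X.fib) :
    X.dot X.K D = 2 * (a * X.e - b) + a * (2 * (X.g : ℝ) - 2 - X.e) := by
  simp only [SurfaceData.dot, h, X.K_class, map_add, map_smul, LinearMap.add_apply,
    LinearMap.smul_apply, smul_eq_mul, X.inter_symm (X.cls X.fib) (X.cls X.C₀), X.C₀_dot_fib,
    X.fib_sq, X.C₀_sq]
  ring

/-- A divisor numerically equivalent to a fibre has negative canonical degree, so `l ≤ 0`. -/
theorem l_nonpos_of_cls_eq_fib {D : X.Div} (h : X.cls D = X.cls X.fib) : X.l D ≤ 0 := by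
  have h' : X.cls D = (0 : ℝ) • X.cls X.C₀ + (1 : ℝ) • X.cls X.fib := by simp [h]
  have hK : X.dot X.K D ≤ 0 := by
    rw [X.dot_K_of_cls_eq h']
    norm_num
  unfold SurfaceData.l
  split_ifs <;> exact div_nonpos_of_nonpos_of_nonneg hK (by positivity)

theorem l_le_abs_of_cls_eq (he : 0 < X.e) {D : X.Div} {a b : ℤ} (ha : 0 < a) (hb : a * X.e ≤ b)
    (h : X.cls D = (a : ℝ) • X.cls X.C₀ + (b : ℝ) • X.cls X.fib) :
    X.l D ≤ |2 * (X.g : ℝ) - 2 - X.e| := by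
  have ha' : (1 : ℝ) ≤ a := by exact_mod_cast ha
  have he' : (1 : ℝ) ≤ X.e := by exact_mod_cast he
  have hb' : (a : ℝ) * X.e ≤ b := by exact_mod_cast hb
  have hsq : (a : ℝ) ≤ X.sq D := by
    rw [X.sq_of_cls_eq h]
    exact le_mul_of_one_le_right (by linarith) (by nlinarith)
  have hK : X.dot X.K D ≤ |2 * (X.g : ℝ) - 2 - X.e| * X.sq D := by
    rw [X.dot_K_of_cls_eq h]
    have h₁ := mul_le_mul_of_nonneg_left (le_abs_self (2 * (X.g : ℝ) - 2 - X.e))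
      (zero_le_one.trans ha')
    have h₂ := mul_le_mul_of_nonneg_left hsq (abs_nonneg (2 * (X.g : ℝ) - 2 - X.e))
    linarith
  have hpos : 0 < X.sq D := by linarith
  rw [SurfaceData.l, if_neg hpos.ne', max_eq_right (ha'.trans hsq)]
  exact (div_le_iff₀ hpos).mpr hK

end RuledSurfaceData

/-- On a geometrically ruled surface `X` with invariant `e > 0`, section `C₀`
and fibre `f`, every curve `F` satisfies
`l_F ≤ max{2, |2g−2−e|, l_{C₀}, l_f}`. -/
theorem ruled_surface_l_bound (X : RuledSurfaceData) (he : 0 < X.e) :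
    ∀ F : X.Div, X.IsCurve F →
      X.l F ≤ max (max 2 |2 * (X.g : ℝ) - 2 - (X.e : ℝ)|)
        (max (X.l X.C₀) (X.l X.fib)) := by
  intro F hF
  rcases X.curve_class F hF with h | h | ⟨a, b, ha, hb, h⟩
  · have hC : X.sq X.C₀ ≠ 0 := by
      have : (X.e : ℝ) ≠ 0 := by exact_mod_cast he.ne'
      simpa [SurfaceData.sq, SurfaceData.dot, X.C₀_sq] using this
    exact (X.l_eq_of_cls_eq h hC).le.trans ((le_max_left _ _).trans (le_max_right _ _))
  · exact (X.l_nonpos_of_cls_eq_fib h).trans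
      (zero_le_two.trans ((le_max_left _ _).trans (le_max_left _ _)))
  · exact (X.l_le_abs_of_cls_eq he ha hb h).trans
      ((le_max_right _ _).trans (le_max_left _ _))
end

section
/- Let X be a smooth projective surface over ℂ with Picard number 2 and NE̅(X) = ℝ≥0[C₁] + ℝ≥0[C₂], where C₁, C₂ are curves with C₁² = 0 and C₂² < 0, and suppose K_X ≡ aC₁ + bC₂ with a, b ≥ 0. If D ≡ a₁C₁ + a₂C₂ is a curve with a₁, a₂ > 0, D² > 0 and a₁ ≤ a, then a₂ ≤ 2a(C₁·C₂)(−C₂²)⁻¹ and D² ≤ 4a²(C₁·C₂)²(−C₂²)⁻¹. -/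
theorem SurfaceData.sq_eq_of_cls_eq (X : SurfaceData) {C₁ C₂ D : X.Div} {a₁ a₂ : ℝ}
    (hD : X.cls D = a₁ • X.cls C₁ + a₂ • X.cls C₂) :
    X.sq D = a₁ ^ 2 * X.sq C₁ + 2 * a₁ * a₂ * X.dot C₁ C₂ + a₂ ^ 2 * X.sq C₂ := by
  simp only [SurfaceData.sq, SurfaceData.dot, hD, map_add, map_smul, LinearMap.add_apply,
    LinearMap.smul_apply, smul_eq_mul, X.inter_symm (X.cls C₂) (X.cls C₁)]
  ring

/-- If `K_X ≡ aC₁ + bC₂` with `a, b ≥ 0` and a curve `D ≡ a₁C₁ + a₂C₂` has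
`a₁, a₂ > 0`, `D² > 0` and `a₁ ≤ a`, then `a₂ ≤ 2a(C₁·C₂)(−C₂²)⁻¹` and
`D² ≤ 4a²(C₁·C₂)²(−C₂²)⁻¹`. -/
theorem sq_bound_of_small_first_coefficient (X : SurfaceData)
    (hρ : X.picardNumber = 2)
    (C₁ C₂ : X.Div) (hC₁ : X.IsCurve C₁) (hC₂ : X.IsCurve C₂)
    (hC₁sq : X.sq C₁ = 0) (hC₂sq : X.sq C₂ < 0)
    (hcone : X.MoriConeGenBy C₁ C₂)
    (a b : ℝ) (ha : 0 ≤ a) (hb : 0 ≤ b)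
    (hK : X.cls X.K = a • X.cls C₁ + b • X.cls C₂)
    (D : X.Div) (hD : X.IsCurve D) (a₁ a₂ : ℝ)
    (hDcls : X.cls D = a₁ • X.cls C₁ + a₂ • X.cls C₂)
    (ha₁ : 0 < a₁) (ha₂ : 0 < a₂) (hDsq : 0 < X.sq D) (hle : a₁ ≤ a) :
    a₂ ≤ 2 * a * X.dot C₁ C₂ * (-X.sq C₂)⁻¹ ∧
      X.sq D ≤ 4 * a ^ 2 * (X.dot C₁ C₂) ^ 2 * (-X.sq C₂)⁻¹ := by
  have hs : 0 < -X.sq C₂ := neg_pos.mpr hC₂sq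
  have hsq : X.sq D = a₂ * (2 * a₁ * X.dot C₁ C₂ - a₂ * -X.sq C₂) := by
    rw [X.sq_eq_of_cls_eq hDcls, hC₁sq]
    ring
  have hlt : 0 < 2 * a₁ * X.dot C₁ C₂ - a₂ * -X.sq C₂ :=
    pos_of_mul_pos_right (hsq ▸ hDsq) ha₂.le
  have hdot : 0 < X.dot C₁ C₂ :=
    pos_of_mul_pos_right (by linarith [mul_pos ha₂ hs]) (by positivity : 0 ≤ 2 * a₁)
  have hmono : 2 * a₁ * X.dot C₁ C₂ ≤ 2 * a * X.dot C₁ C₂ := by gcongr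
  have hbound : a₂ ≤ 2 * a * X.dot C₁ C₂ * (-X.sq C₂)⁻¹ := by
    rw [← div_eq_mul_inv, le_div_iff₀ hs]
    linarith
  refine ⟨hbound, ?_⟩
  calc X.sq D ≤ a₂ * (2 * a * X.dot C₁ C₂) := by
        rw [hsq]
        gcongr
        linarith [mul_pos ha₂ hs]
    _ ≤ 2 * a * X.dot C₁ C₂ * (-X.sq C₂)⁻¹ * (2 * a * X.dot C₁ C₂) := by gcongr
    _ = 4 * a ^ 2 * (X.dot C₁ C₂) ^ 2 * (-X.sq C₂)⁻¹ := by ring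
end
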